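/- arXiv:2210.07139 — 2 statements merged into one kernel-verified Lean document; each statement's English description precedes it below -/
import Mathlib

section
/- Let G be a finite simple connected graph with adjacency matrix A and let u be a vertex of eccentricity e. Then u is pseudo-distance-regular if and only if |Φ_u| = e+1 and there exists a real polynomial p of degree e such that for every vertex w, (p(A) e_u)_w ≠ 0 if and only if d(u,w) = e. -/
open Polynomial Matrix

/-- `u` has eccentricity `e` in `G`. -/
def IsEcc {V : Type*} (G : SimpleGraph V) (u : V) (e : ℕ) : Prop :=
  (∀ v, G.dist u v ≤ e) ∧ ∃ v, G.dist u v = e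

/-- The eigenvalue support of the vertex `u`: those eigenvalues `θ` of `A` whose spectral
idempotent `E_θ` satisfies `E_θ e_u ≠ 0`, equivalently those `θ` admitting an eigenvector
not vanishing at `u`. -/
def eSupport {V : Type*} [Fintype V] (A : Matrix V V ℝ) (u : V) : Set ℝ :=
  {θ : ℝ | ∃ w : V → ℝ, A *ᵥ w = θ • w ∧ w u ≠ 0}

/-- The vertex `u`, of eccentricity `e`, is pseudo-distance-regular: `|Φ_u| = e + 1` and for
each `0 ≤ i ≤ e` there is a polynomial `p_i` of degree `i` with `(p_i(A) e_u)_w ≠ 0` iff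
`d(u,w) = i`. -/
def IsPseudoDistRegular {V : Type*} [Fintype V] [DecidableEq V] (G : SimpleGraph V)
    (A : Matrix V V ℝ) (u : V) (e : ℕ) : Prop :=
  (eSupport A u).ncard = e + 1 ∧
    ∀ i ≤ e, ∃ p : Polynomial ℝ, p.degree = (i : WithBot ℕ) ∧
      ∀ w, (aeval A p *ᵥ Pi.single u 1) w ≠ 0 ↔ G.dist u w = i

/-- The powers of the adjacency matrix vanish outside the ball of the corresponding radius. -/
theorem adjMatrix_pow_mulVec_single_eq_zero {V : Type*} [Fintype V] [DecidableEq V]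
    (G : SimpleGraph V) [DecidableRel G.Adj] (u w : V) (n : ℕ) (h : n < G.dist u w) :
    (G.adjMatrix ℝ ^ n *ᵥ Pi.single u 1) w = 0 := by
  rw [mulVec_single_one, col_apply, SimpleGraph.adjMatrix_pow_apply_eq_card_walk,
    Nat.cast_eq_zero, Fintype.card_eq_zero_iff]
  refine ⟨fun ⟨q, hq⟩ => ?_⟩
  have := SimpleGraph.dist_le q
  rw [SimpleGraph.dist_comm] at this
  simp only [Set.mem_ofPred_eq] at hq
  omega

theorem adjMatrix_pow_dist_mulVec_single_pos {V : Type*} [Fintype V] [DecidableEq V]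
    (G : SimpleGraph V) [DecidableRel G.Adj] (hconn : G.Connected) (u w : V) :
    0 < (G.adjMatrix ℝ ^ G.dist u w *ᵥ Pi.single u 1) w := by
  rw [mulVec_single_one, col_apply, SimpleGraph.adjMatrix_pow_apply_eq_card_walk,
    Nat.cast_pos, Fintype.card_pos_iff]
  obtain ⟨q, hq⟩ := hconn.exists_walk_length_eq_dist w u
  exact ⟨⟨q, by rw [Set.mem_ofPred_eq, hq, SimpleGraph.dist_comm]⟩⟩

/-- On vertices at distance at least `n` from `u`, only the coefficient of degree `n` of a
polynomial of degree at most `n` contributes to `p(A) e_u`. -/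
theorem aeval_adjMatrix_mulVec_single_apply {V : Type*} [Fintype V] [DecidableEq V]
    (G : SimpleGraph V) [DecidableRel G.Adj] (u w : V) (p : ℝ[X]) (n : ℕ)
    (hp : p.natDegree ≤ n) (hn : n ≤ G.dist u w) :
    (aeval (G.adjMatrix ℝ) p *ᵥ Pi.single u 1) w =
      p.coeff n * (G.adjMatrix ℝ ^ n *ᵥ Pi.single u 1) w := by
  rw [aeval_eq_sum_range' (Nat.lt_succ_of_le hp), sum_mulVec, Finset.sum_apply,
    Finset.sum_range_succ, Finset.sum_eq_zero, zero_add, smul_mulVec, Pi.smul_apply, smul_eq_mul]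
  intro k hk
  rw [smul_mulVec, Pi.smul_apply,
    adjMatrix_pow_mulVec_single_eq_zero G u w k (by have := Finset.mem_range.1 hk; omega),
    smul_zero]

theorem exists_adj_dist_eq {V : Type*} (G : SimpleGraph V) (hconn : G.Connected) (u z : V) (i : ℕ)
    (h : G.dist u z = i + 1) : ∃ w, G.Adj w z ∧ G.dist u w = i := by
  obtain ⟨q, hq⟩ := hconn.exists_walk_length_eq_dist z u
  rw [SimpleGraph.dist_comm, h] at hq
  cases q with
  | nil => simp at hq
  | @cons _ w _ hzw q =>
    refine ⟨w, hzw.symm, ?_⟩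
    have h₁ := SimpleGraph.dist_le q
    have h₂ := hconn.dist_triangle (u := u) (v := w) (w := z)
    rw [SimpleGraph.dist_eq_one_iff_adj.2 hzw.symm] at h₂
    rw [SimpleGraph.dist_comm] at h₁
    simp only [SimpleGraph.Walk.length_cons] at hq
    omega

theorem aeval_mulVec_eigenvector {V : Type*} [Fintype V] [DecidableEq V]
    (A : Matrix V V ℝ) (p : ℝ[X]) (θ : ℝ) (x : V → ℝ) (h : A *ᵥ x = θ • x) :
    aeval A p *ᵥ x = p.eval θ • x := by
  induction p using Polynomial.induction_on' with
  | add p q hp hq => simp [add_mulVec, add_smul, hp, hq]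
  | monomial n a =>
    have hpow : ∀ n : ℕ, A ^ n *ᵥ x = θ ^ n • x := by
      intro n
      induction n with
      | zero => simp
      | succ n ih => rw [pow_succ, ← mulVec_mulVec, h, mulVec_smul, ih, smul_smul, pow_succ']
    rw [aeval_monomial, eval_monomial, ← Algebra.smul_def, smul_mulVec, hpow, smul_smul]

/-- A symmetric matrix `A` and polynomial `p` satisfy `p(A) e_u = 0` as soon as `p` vanishes on
the eigenvalue support of `u`. -/
theorem aeval_mulVec_single_eq_zero {V : Type*} [Fintype V] [DecidableEq V]
    (A : Matrix V V ℝ) (hA : A.IsHermitian) (u : V) (p : ℝ[X])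
    (hp : ∀ θ ∈ eSupport A u, p.eval θ = 0) : aeval A p *ᵥ Pi.single u 1 = 0 := by
  have hsymm : (aeval A p)ᵀ = aeval A p := by
    have hT : Aᵀ = A := by simpa [IsHermitian, conjTranspose_eq_transpose_of_trivial] using hA
    rw [aeval_eq_sum_range, transpose_sum]
    simp [transpose_smul, transpose_pow, hT]
  have key : WithLp.toLp 2 (aeval A p *ᵥ Pi.single u 1) = (0 : EuclideanSpace ℝ V) := by
    refine InnerProductSpace.ext_inner_right_basis (𝕜 := ℝ) hA.eigenvectorBasis.toBasis
      fun j => ?_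
    set x : V → ℝ := ⇑(hA.eigenvectorBasis j)
    have hAx : A *ᵥ x = hA.eigenvalues j • x := hA.mulVec_eigenvectorBasis j
    rw [OrthonormalBasis.coe_toBasis, inner_zero_left, EuclideanSpace.inner_eq_star_dotProduct]
    change x ⬝ᵥ star (aeval A p *ᵥ Pi.single u 1) = 0
    rw [star_trivial, dotProduct_mulVec, ← mulVec_transpose, hsymm,
      aeval_mulVec_eigenvector A p _ x hAx, dotProduct_single_one, Pi.smul_apply, smul_eq_mul]
    by_cases hu : x u = 0
    · rw [hu, mul_zero]
    · rw [hp _ ⟨x, hAx, hu⟩, zero_mul]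
  exact congrArg WithLp.ofLp key

/-- There is a monic polynomial of degree `n` for which `p(A) e_u` vanishes off the sphere of
radius `n` around `u`. -/
def HasSpherePolynomial {V : Type*} [Fintype V] [DecidableEq V] (G : SimpleGraph V)
    [DecidableRel G.Adj] (u : V) (n : ℕ) : Prop :=
  ∃ p : ℝ[X], p.Monic ∧ p.natDegree = n ∧
    ∀ w, G.dist u w ≠ n → (aeval (G.adjMatrix ℝ) p *ᵥ Pi.single u 1) w = 0

theorem hasSpherePolynomial_of_degree_eq {V : Type*} [Fintype V] [DecidableEq V]
    (G : SimpleGraph V) [DecidableRel G.Adj] (u : V) (n : ℕ) (p : ℝ[X]) (hp : p.degree = n)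
    (h : ∀ w, G.dist u w ≠ n → (aeval (G.adjMatrix ℝ) p *ᵥ Pi.single u 1) w = 0) :
    HasSpherePolynomial G u n := by
  have h0 : p ≠ 0 := by rintro rfl; simp at hp
  refine ⟨p * C p.leadingCoeff⁻¹, monic_mul_leadingCoeff_inv h0, ?_, fun w hw => ?_⟩
  · rw [natDegree_mul_leadingCoeff_inv _ h0]
    exact natDegree_eq_of_degree_eq_some hp
  · rw [mul_comm, ← smul_eq_C_mul, map_smul, smul_mulVec, Pi.smul_apply, h w hw, smul_zero]

/-- The three-term recurrence run backwards: the sphere polynomials of degrees `j + 1` and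
`j + 2` produce one of degree `j`. -/
theorem HasSpherePolynomial.pred {V : Type*} [Fintype V] [DecidableEq V]
    (G : SimpleGraph V) [DecidableRel G.Adj] (hconn : G.Connected) (u : V) (j : ℕ)
    (hj : ∃ z, G.dist u z = j + 1) (h₁ : HasSpherePolynomial G u (j + 1))
    (h₂ : HasSpherePolynomial G u (j + 2)) : HasSpherePolynomial G u j := by
  obtain ⟨p, hpm, hpd, hp⟩ := h₁
  obtain ⟨q, hqm, hqd, hq⟩ := h₂
  obtain ⟨z, hz⟩ := hj
  obtain ⟨w, hwz, hw⟩ := exists_adj_dist_eq G hconn u z j hz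
  have hpc : p.coeff (j + 1) = 1 := by rw [← hpd]; exact hpm
  have hqc : q.coeff (j + 2) = 1 := by rw [← hqd]; exact hqm
  set a : ℝ := p.coeff j - q.coeff (j + 1) with ha
  set r : ℝ[X] := X * p - q - C a * p with hr
  have hrd : r.natDegree ≤ j := by
    rw [natDegree_le_iff_coeff_eq_zero]
    intro n hn
    obtain ⟨m, rfl⟩ : ∃ m, n = m + 1 := ⟨n - 1, by omega⟩
    rw [hr, coeff_sub, coeff_sub, coeff_X_mul, coeff_C_mul]
    rcases Nat.lt_trichotomy m (j + 1) with hm | rfl | hm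
    · obtain rfl : m = j := by omega
      rw [hpc, ha]; ring
    · rw [hpc, hqc, coeff_eq_zero_of_natDegree_lt (by omega)]; ring
    · rw [coeff_eq_zero_of_natDegree_lt (n := m) (by omega),
        coeff_eq_zero_of_natDegree_lt (n := m + 1) (by omega),
        coeff_eq_zero_of_natDegree_lt (n := m + 1) (by omega)]
      ring
  have happly : ∀ v, (aeval (G.adjMatrix ℝ) r *ᵥ Pi.single u 1) v =
      ∑ y ∈ G.neighborFinset v, (aeval (G.adjMatrix ℝ) p *ᵥ Pi.single u 1) y -
        (aeval (G.adjMatrix ℝ) q *ᵥ Pi.single u 1) v -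
        a * (aeval (G.adjMatrix ℝ) p *ᵥ Pi.single u 1) v := by
    intro v
    rw [← SimpleGraph.adjMatrix_mulVec_apply, hr, ← smul_eq_C_mul]
    simp only [map_sub, map_mul, aeval_X, map_smul, sub_mulVec, smul_mulVec, mulVec_mulVec,
      Pi.sub_apply, Pi.smul_apply, smul_eq_mul]
  refine hasSpherePolynomial_of_degree_eq G u j r ?_ fun v hv => ?_
  · refine degree_eq_of_le_of_coeff_ne_zero (degree_le_of_natDegree_le hrd) fun hc => ?_
    have h0 := happly w
    rw [aeval_adjMatrix_mulVec_single_apply G u w r j hrd hw.ge, hc, zero_mul,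
      hq w (by omega), hp w (by omega), mul_zero, sub_zero, sub_zero] at h0
    refine absurd h0 (ne_of_lt ?_)
    have hpos : ∀ y, G.dist u y = j + 1 →
        0 < (aeval (G.adjMatrix ℝ) p *ᵥ Pi.single u 1) y := by
      intro y hy
      rw [aeval_adjMatrix_mulVec_single_apply G u y p (j + 1) hpd.le hy.ge, hpc, one_mul, ← hy]
      exact adjMatrix_pow_dist_mulVec_single_pos G hconn u y
    refine Finset.sum_pos' (fun y _ => ?_) ⟨z, by simpa using hwz, hpos z hz⟩
    by_cases hy : G.dist u y = j + 1
    · exact (hpos y hy).le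
    · exact (hp y hy).ge
  · rcases lt_or_gt_of_ne hv with hv | hv
    · rw [happly, hq v (by omega), hp v (by omega), Finset.sum_eq_zero]
      · ring
      · intro y hy
        refine hp y ?_
        have hvy : G.Adj v y := by simpa using hy
        have := hconn.dist_triangle (u := u) (v := v) (w := y)
        rw [SimpleGraph.dist_eq_one_iff_adj.2 hvy] at this
        omega
    · rw [aeval_adjMatrix_mulVec_single_apply G u v r j hrd hv.le,
        adjMatrix_pow_mulVec_single_eq_zero G u v j hv, mul_zero]

theorem HasSpherePolynomial.exists_degree_eq {V : Type*} [Fintype V] [DecidableEq V]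
    (G : SimpleGraph V) [DecidableRel G.Adj] (hconn : G.Connected) (u : V) (n : ℕ)
    (h : HasSpherePolynomial G u n) :
    ∃ p : ℝ[X], p.degree = (n : WithBot ℕ) ∧
      ∀ w, (aeval (G.adjMatrix ℝ) p *ᵥ Pi.single u 1) w ≠ 0 ↔ G.dist u w = n := by
  obtain ⟨p, hpm, hpd, hp⟩ := h
  refine ⟨p, by rw [degree_eq_natDegree hpm.ne_zero, hpd],
    fun w => ⟨fun hw => by_contra fun hne => hw (hp w hne), fun hw => ?_⟩⟩
  have hpc : p.coeff n = 1 := by rw [← hpd]; exact hpm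
  rw [aeval_adjMatrix_mulVec_single_apply G u w p n hpd.le hw.ge, hpc, one_mul, ← hw]
  exact (adjMatrix_pow_dist_mulVec_single_pos G hconn u w).ne'

/-- A polynomial with roots exactly the eigenvalue support of `u` annihilates `e_u`. -/
theorem hasSpherePolynomial_of_ncard_eSupport {V : Type*} [Fintype V] [DecidableEq V]
    (G : SimpleGraph V) [DecidableRel G.Adj] (u : V) (n : ℕ)
    (h : (eSupport (G.adjMatrix ℝ) u).ncard = n + 1) : HasSpherePolynomial G u (n + 1) := by
  have hfin : (eSupport (G.adjMatrix ℝ) u).Finite := Set.finite_of_ncard_ne_zero (by omega)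
  have hA : (G.adjMatrix ℝ).IsHermitian := by
    rw [IsHermitian, conjTranspose_eq_transpose_of_trivial, SimpleGraph.transpose_adjMatrix]
  refine ⟨∏ θ ∈ hfin.toFinset, (X - C θ), monic_prod_X_sub_C _ _, ?_, fun w _ => ?_⟩
  · rw [natDegree_finsetProd_X_sub_C_eq_card, ← h, Set.ncard_eq_toFinset_card _ hfin]
  · rw [aeval_mulVec_single_eq_zero _ hA, Pi.zero_apply]
    intro θ hθ
    rw [eval_prod]
    exact Finset.prod_eq_zero (hfin.mem_toFinset.2 hθ) (by simp)

theorem pseudo_distance_regular_iff_last_polynomial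
    {V : Type*} [Fintype V] [DecidableEq V] (G : SimpleGraph V) [DecidableRel G.Adj]
    (hconn : G.Connected) (u : V) (e : ℕ) (hecc : IsEcc G u e) :
    IsPseudoDistRegular G (G.adjMatrix ℝ) u e ↔
      (eSupport (G.adjMatrix ℝ) u).ncard = e + 1 ∧
        ∃ p : Polynomial ℝ, p.degree = (e : WithBot ℕ) ∧
          ∀ w, (aeval (G.adjMatrix ℝ) p *ᵥ Pi.single u 1) w ≠ 0 ↔ G.dist u w = e := by
  refine ⟨fun ⟨hcard, h⟩ => ⟨hcard, h e le_rfl⟩, fun ⟨hcard, p, hpd, hp⟩ => ⟨hcard, fun i hi => ?_⟩⟩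
  have key : (∃ z, G.dist u z = i) ∧ HasSpherePolynomial G u i ∧
      HasSpherePolynomial G u (i + 1) := by
    induction hi using Nat.decreasingInduction with
    | self =>
      exact ⟨hecc.2, hasSpherePolynomial_of_degree_eq G u e p hpd
        fun w hw => not_not.1 fun h => hw ((hp w).1 h),
        hasSpherePolynomial_of_ncard_eSupport G u e hcard⟩
    | of_succ j _ ih =>
      obtain ⟨⟨z, hz⟩, h₁, h₂⟩ := ih
      obtain ⟨w, -, hw⟩ := exists_adj_dist_eq G hconn u z j hz
      exact ⟨⟨w, hw⟩, HasSpherePolynomial.pred G hconn u j ⟨z, hz⟩ h₁ h₂, h₁⟩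
  exact HasSpherePolynomial.exists_degree_eq G hconn u i key.2.1
end

section
/- Let G be a finite simple connected graph with adjacency matrix A, largest eigenvalue λ, and Perron eigenvector v. Let u be a vertex of eccentricity e and let 0 ≤ k ≤ e. Then there exists a real polynomial p of degree at most k with ‖p‖_u ≤ 1 and p(λ) = (1/v_u)·√(Σ_{w ∈ N_k(u)} v_w²) if and only if there exists a real polynomial q of degree at most k such that q(A) e_u = Σ_{w ∈ N_k(u)} (v_w/v_u) e_w. -/
open Polynomial Matrix

/-- The `u`-local inner product of polynomials: `⟨p, q⟩_u = e_uᵀ p(A) q(A) e_u`. -/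
noncomputable def localIP {V : Type*} [Fintype V] [DecidableEq V] (A : Matrix V V ℝ)
    (u : V) (p q : Polynomial ℝ) : ℝ :=
  (aeval A (p * q)) u u

/-- `lam` is the largest eigenvalue of `A` and `pv` is the Perron eigenvector: a unit-norm
`lam`-eigenvector with all entries positive. -/
def IsPerron {V : Type*} [Fintype V] (A : Matrix V V ℝ) (lam : ℝ) (pv : V → ℝ) : Prop :=
  A *ᵥ pv = lam • pv ∧ (∀ w, 0 < pv w) ∧ (∑ w, pv w ^ 2 = 1) ∧
    ∀ (θ : ℝ) (w : V → ℝ), w ≠ 0 → A *ᵥ w = θ • w → θ ≤ lam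

namespace Matrix

variable {V : Type*} [Fintype V] [DecidableEq V]

theorem IsSymm.aeval {A : Matrix V V ℝ} (hA : A.IsSymm) (p : ℝ[X]) :
    (aeval A p).IsSymm := by
  induction p using Polynomial.induction_on' with
  | add p q hp hq => rw [map_add]; exact hp.add hq
  | monomial n a =>
    rw [aeval_monomial, ← Algebra.smul_def]
    exact (hA.pow n).smul a

theorem aeval_mulVec_of_mulVec_eq_smul {A : Matrix V V ℝ} {x : V → ℝ} {c : ℝ}
    (h : A *ᵥ x = c • x) (p : ℝ[X]) : aeval A p *ᵥ x = p.eval c • x := by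
  have hpow (n : ℕ) : A ^ n *ᵥ x = c ^ n • x := by
    induction n with
    | zero => simp
    | succ n ih => rw [pow_succ, ← mulVec_mulVec, h, mulVec_smul, ih, smul_smul, pow_succ']
  induction p using Polynomial.induction_on' with
  | add p q hp hq => rw [map_add, add_mulVec, hp, hq, eval_add, add_smul]
  | monomial n a =>
    rw [aeval_monomial, ← Algebra.smul_def, smul_mulVec, hpow, smul_smul, eval_monomial]

end Matrix

theorem SimpleGraph.aeval_adjMatrix_apply_eq_zero {V : Type*} [Fintype V] [DecidableEq V]
    (G : SimpleGraph V) [DecidableRel G.Adj] {p : ℝ[X]} {k : ℕ} (hp : p.degree ≤ k) {u w : V}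
    (h : k < G.dist u w) : aeval (G.adjMatrix ℝ) p w u = 0 := by
  rw [aeval_eq_sum_range, Matrix.sum_apply]
  refine Finset.sum_eq_zero fun n hn => ?_
  have hnk : n ≤ k :=
    (Nat.lt_succ_iff.mp (Finset.mem_range.mp hn)).trans (natDegree_le_of_degree_le hp)
  rw [Matrix.smul_apply, adjMatrix_pow_apply_eq_card_walk]
  have : IsEmpty {c : G.Walk w u | c.length = n} := by
    refine ⟨fun c => ?_⟩
    have := dist_le c.1
    rw [c.2, G.dist_comm] at this
    omega
  rw [Fintype.card_eq_zero]
  simp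

theorem localIP_self_eq_sum_sq {V : Type*} [Fintype V] [DecidableEq V] {A : Matrix V V ℝ}
    (hA : A.IsSymm) (u : V) (p : ℝ[X]) :
    localIP A u p p = ∑ w, (aeval A p w u) ^ 2 := by
  rw [localIP, map_mul, Matrix.mul_apply]
  refine Finset.sum_congr rfl fun w _ => ?_
  rw [(hA.aeval p).apply w u, sq]

/-- The local adjacency polynomial bound is attained at `k` iff some polynomial `q` of degree
at most `k` satisfies `q(A) e_u = ∑_{w ∈ N_k(u)} (v_w / v_u) e_w`. -/
theorem local_adjacency_polynomial_bound_tight_iff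
    {V : Type*} [Fintype V] [DecidableEq V] (G : SimpleGraph V) [DecidableRel G.Adj]
    (hconn : G.Connected) (lam : ℝ) (pv : V → ℝ) (hperron : IsPerron (G.adjMatrix ℝ) lam pv)
    (u : V) (e k : ℕ) (hecc : IsEcc G u e) (hk : k ≤ e) :
    (∃ p : Polynomial ℝ, p.degree ≤ (k : WithBot ℕ) ∧
        Real.sqrt (localIP (G.adjMatrix ℝ) u p p) ≤ 1 ∧
        p.eval lam = (1 / pv u) *
          Real.sqrt (∑ w ∈ Finset.univ.filter fun w => G.dist u w ≤ k, pv w ^ 2)) ↔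
      (∃ q : Polynomial ℝ, q.degree ≤ (k : WithBot ℕ) ∧
        aeval (G.adjMatrix ℝ) q *ᵥ Pi.single u 1
          = fun w => if G.dist u w ≤ k then pv w / pv u else 0) := by
  set A := G.adjMatrix ℝ
  set S := ∑ w ∈ Finset.univ.filter fun w => G.dist u w ≤ k, pv w ^ 2 with hS_def
  obtain ⟨heig, hpos, -, -⟩ := hperron
  have hA : A.IsSymm := G.isSymm_adjMatrix
  have hu : pv u ≠ 0 := (hpos u).ne'
  have hSpos : 0 < S := Finset.sum_pos (fun w _ => pow_pos (hpos w) 2) ⟨u, by simp⟩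
  have hsq : √S * √S = S := Real.mul_self_sqrt hSpos.le
  have hsqrt : √S ≠ 0 := (Real.sqrt_pos.mpr hSpos).ne'
  have heval (p : ℝ[X]) : ∑ w, aeval A p w u * pv w = p.eval lam * pv u := by
    have := congrFun (Matrix.aeval_mulVec_of_mulVec_eq_smul heig p) u
    simp only [mulVec, dotProduct, Pi.smul_apply, smul_eq_mul] at this
    rw [← this]
    exact Finset.sum_congr rfl fun w _ => by rw [(hA.aeval p).apply u w]
  constructor
  · rintro ⟨p, hdeg, hnorm, hp⟩
    refine ⟨C (√S / pv u) * p, (degree_C_mul (div_ne_zero hsqrt hu)).trans_le hdeg, ?_⟩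
    have hnorm' : ∑ w, (aeval A p w u) ^ 2 ≤ 1 := by
      rwa [Real.sqrt_le_one, localIP_self_eq_sum_sq hA] at hnorm
    have hsupp (w : V) (hw : ¬ G.dist u w ≤ k) : aeval A p w u = 0 :=
      G.aeval_adjMatrix_apply_eq_zero hdeg (not_le.mp hw)
    have hinner : ∑ w, aeval A p w u * pv w = √S := by
      rw [heval, hp]; field_simp
    have hdist : ∑ w, (√S * aeval A p w u - if G.dist u w ≤ k then pv w else 0) ^ 2 ≤ 0 := by
      calc _ = ∑ w, (S * (aeval A p w u) ^ 2 - 2 * √S * (aeval A p w u * pv w)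
              + if G.dist u w ≤ k then pv w ^ 2 else 0) := by
            refine Finset.sum_congr rfl fun w _ => ?_
            split_ifs with hw
            · linear_combination (aeval A p w u) ^ 2 * hsq
            · rw [hsupp w hw]; ring
        _ = S * ∑ w, (aeval A p w u) ^ 2 - 2 * √S * √S + S := by
            rw [Finset.sum_add_distrib, Finset.sum_sub_distrib, ← Finset.mul_sum,
              ← Finset.mul_sum, hinner, ← Finset.sum_filter]
        _ ≤ 0 := by nlinarith
    ext w
    have hw := (Finset.sum_eq_zero_iff_of_nonneg fun w _ => sq_nonneg _).mp
      (hdist.antisymm (Finset.sum_nonneg fun w _ => sq_nonneg _)) w (Finset.mem_univ w)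
    have hw' := sub_eq_zero.mp (pow_eq_zero_iff two_ne_zero |>.mp hw)
    rw [mulVec_single_one, map_mul, aeval_C, ← Algebra.smul_def, col_apply, Matrix.smul_apply,
      smul_eq_mul, div_mul_eq_mul_div, hw', ite_div, zero_div]
  · rintro ⟨q, hdeg, hq⟩
    have hq' (w : V) : aeval A q w u = if G.dist u w ≤ k then pv w / pv u else 0 := by
      rw [← congrFun hq w, mulVec_single_one, col_apply]
    refine ⟨C (pv u / √S) * q, (degree_C_mul (div_ne_zero hu hsqrt)).trans_le hdeg, ?_, ?_⟩
    · rw [Real.sqrt_le_one, localIP_self_eq_sum_sq hA]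
      refine le_of_eq ?_
      calc _ = ∑ w, if G.dist u w ≤ k then pv w ^ 2 / S else 0 := by
            refine Finset.sum_congr rfl fun w _ => ?_
            rw [map_mul, aeval_C, ← Algebra.smul_def, Matrix.smul_apply, hq', smul_eq_mul]
            split_ifs with hw
            · rw [mul_pow, div_pow, div_pow, Real.sq_sqrt hSpos.le]; field_simp
            · ring
        _ = 1 := by rw [← Finset.sum_filter, ← Finset.sum_div, div_self hSpos.ne']
    · have hqeval : q.eval lam * pv u = S / pv u := by
        rw [← heval, hS_def, Finset.sum_div, Finset.sum_filter]
        refine Finset.sum_congr rfl fun w _ => ?_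
        rw [hq']
        split_ifs <;> ring
      rw [eval_mul, eval_C, div_mul_eq_mul_div, mul_comm, hqeval, div_div, div_eq_iff (by positivity)]
      field_simp
      rw [sq, hsq]
end
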